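/- arXiv:0709.1204 — 3 statements merged into one kernel-verified Lean document; each statement's English description precedes it below -/
import Mathlib

section
/- If A ⊆ ℕ, x ∈ ℕ, and the series ∑_{a ∈ A, a > x} 1/(a − x) diverges (i.e., ¬ Summable of (fun a : ↥{a ∈ A | a > x} ↦ (1 : ℝ) / ((a : ℝ) − x))), then A is harmonic, i.e., ¬ Summable (fun a : ↥A ↦ (1 : ℝ) / (a : ℝ)). -/
/-- A set `A ⊆ ℕ` is harmonic if the series of reciprocals of its elements diverges. -/
def Harmonic (A : Set ℕ) : Prop :=
  ¬ Summable (fun a : A => (1 : ℝ) / (a : ℝ))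

/-- Summability over a set of indices passes to subsets. -/
theorem summable_subtype_of_subset {ι : Type*} {f : ι → ℝ} {s t : Set ι} (hst : s ⊆ t)
    (hf : Summable (fun i : t => f i)) : Summable (fun i : s => f i) :=
  hf.comp_injective (Set.inclusion_injective hst)

/-- Hindman's key estimate: if `∑_{a ∈ A, a > x} 1/(a - x)` diverges, then `A` is harmonic. -/
theorem harmonic_of_shifted_divergence (A : Set ℕ) (x : ℕ)
    (h : ¬ Summable (fun a : {a ∈ A | a > x} => (1 : ℝ) / ((a : ℝ) - (x : ℝ)))) :
    Harmonic A := by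
  intro hA
  have hsub : Summable (fun a : {a ∈ A | a > x} => (1 : ℝ) / (a : ℝ)) :=
    summable_subtype_of_subset (f := fun n : ℕ => (1 : ℝ) / (n : ℝ))
      (Set.sep_subset A (fun a => a > x)) hA
  have key (a : ℕ) (ha : x < a) : 0 ≤ 1 / ((a : ℝ) - x) ∧
      1 / ((a : ℝ) - x) ≤ ((x : ℝ) + 1) * (1 / (a : ℝ)) := by
    have ha' : (x : ℝ) + 1 ≤ a := by exact_mod_cast ha
    have hx : (0 : ℝ) ≤ x := Nat.cast_nonneg x
    refine ⟨one_div_nonneg.2 (by linarith), ?_⟩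
    rw [mul_one_div, div_le_div_iff₀ (by linarith) (by linarith)]
    nlinarith [mul_nonneg hx (sub_nonneg.2 ha')]
  exact h (Summable.of_nonneg_of_le (fun a => (key a a.2.2).1) (fun a => (key a a.2.2).2)
    (hsub.mul_left ((x : ℝ) + 1)))
end

section
/- The set of harmonic ultrafilters is a right ideal for the Glazer addition on ultrafilters of ℕ: if p is an ultrafilter on ℕ all of whose members are harmonic sets, and q is any ultrafilter on ℕ, then every member of the Glazer sum p + q is harmonic. Here A ∈ p + q means {x ∈ ℕ : {y ∈ ℕ : y + x ∈ A} ∈ p} ∈ q. -/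
/-- An ultrafilter on `ℕ` is harmonic if all of its members are harmonic sets. -/
def HarmonicUltrafilter (p : Ultrafilter ℕ) : Prop :=
  ∀ A ∈ p, Harmonic A

/-- If a translate `{y | y + x ∈ A}` of `A` is harmonic, then so is `A`. -/
theorem Harmonic.of_translate {A : Set ℕ} {x : ℕ} (h : Harmonic {y : ℕ | y + x ∈ A}) :
    Harmonic A := by
  intro hA
  have hinj : Function.Injective
      (fun y : {y : ℕ | y + x ∈ A} => (⟨(y : ℕ) + x, y.2⟩ : A)) := by
    intro a b hab
    exact Subtype.ext (Nat.add_right_cancel (congrArg Subtype.val hab))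
  refine h (((hA.comp_injective hinj).mul_left ((x : ℝ) + 1)).of_nonneg_of_le
    (fun y => by positivity) ?_)
  rintro ⟨y, hy⟩
  simp only [Function.comp_apply, Nat.cast_add]
  rcases y.eq_zero_or_pos with rfl | hpos
  · simp only [Nat.cast_zero, div_zero]
    positivity
  · have hy1 : (1 : ℝ) ≤ y := by exact_mod_cast hpos
    have hx : (0 : ℝ) ≤ x := x.cast_nonneg
    rw [mul_one_div, div_le_div_iff₀ (by linarith) (by linarith)]
    nlinarith

/-- The harmonic ultrafilters form a right ideal for the Glazer addition:
every member of the Glazer sum `p + q` (where `A ∈ p + q` iff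
`{x | {y | y + x ∈ A} ∈ p} ∈ q`) is harmonic, whenever `p` is harmonic. -/
theorem harmonic_ultrafilters_right_ideal (p q : Ultrafilter ℕ)
    (hp : HarmonicUltrafilter p) (A : Set ℕ)
    (hA : {x : ℕ | {y : ℕ | y + x ∈ A} ∈ p} ∈ q) :
    Harmonic A := by
  obtain ⟨x, hx⟩ := q.nonempty_of_mem hA
  exact (hp _ hx).of_translate
end

section
/- For every harmonic set A ⊆ ℕ there exists a harmonic ultrafilter p on ℕ with A ∈ p. In particular, the set 𝒟 of harmonic ultrafilters is nonempty. -/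
theorem Harmonic.mono {A B : Set ℕ} (hA : Harmonic A) (h : A ⊆ B) : Harmonic B := by
  intro hB
  have hBA := Summable.comp_injective hB (Set.inclusion_injective h)
  exact hA hBA

theorem not_harmonic_empty : ¬ Harmonic ∅ :=
  not_not.2 summable_empty

theorem Harmonic.of_union {A B : Set ℕ} (h : Harmonic (A ∪ B)) : Harmonic A ∨ Harmonic B := by
  by_contra! hAB
  obtain ⟨hA, hB⟩ := hAB
  have hB' : ¬ Harmonic (B \ A) := fun hd ↦ hB (hd.mono Set.sdiff_subset)
  rw [← Set.union_sdiff_self] at h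
  exact h (HasSum.add_disjoint (f := fun n : ℕ ↦ (1 : ℝ) / n) Set.disjoint_sdiff_right
    (not_not.1 hA).hasSum (not_not.1 hB').hasSum).summable

/-- The filter of all sets whose complement is not harmonic. -/
def coharmonicFilter : Filter ℕ :=
  Filter.comk (fun B ↦ ¬ Harmonic B) not_harmonic_empty
    (fun _ hB _ hCB hC ↦ hB (hC.mono hCB))
    (fun _ hB _ hC h ↦ h.of_union.elim hB hC)

/-- Every harmonic set belongs to some harmonic ultrafilter. -/
theorem exists_harmonic_ultrafilter_mem (A : Set ℕ) (hA : Harmonic A) :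
    ∃ p : Ultrafilter ℕ, A ∈ p ∧ ∀ B ∈ p, Harmonic B := by
  have hne : (coharmonicFilter ⊓ Filter.principal A).NeBot := by
    rw [Filter.inf_principal_neBot_iff]
    intro U hU
    by_contra hUA
    exact Filter.mem_comk.1 hU (hA.mono fun n hnA hnU ↦ hUA ⟨n, hnU, hnA⟩)
  obtain ⟨p, hp⟩ := Ultrafilter.exists_le (coharmonicFilter ⊓ Filter.principal A)
  obtain ⟨hpF, hpA⟩ := le_inf_iff.1 hp
  refine ⟨p, Filter.le_principal_iff.1 hpA, fun B hB ↦ ?_⟩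
  by_contra hBn
  have hBc : Bᶜ ∈ coharmonicFilter := by
    simpa only [coharmonicFilter, Filter.mem_comk, compl_compl] using hBn
  exact Ultrafilter.compl_mem_iff_notMem.1 (hpF hBc) hB
end
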